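/- (Theorem 2.) Under the robust adaptation setting, assume additionally that there exists M > 0 such that X_kᵀ X_k ≤ M and g_{k+1}ᵀ g_{k+1} ≤ M for all k ≥ 1, and that ‖w‖ ≤ ε_w for all w ∈ W and ‖v‖ ≤ ε_v for all v ∈ V. Then: (i) the Lyapunov function V_k is nonincreasing, so the parameter approximation errors Ψ̃_k and C̃_k are uniformly bounded; (ii) limsup_{k→∞} ‖x̃_k‖ ≤ ε_v, i.e. the state prediction error is ultimately bounded by ε_v. -/

import Mathlib

open Matrix

lemma aux_proj {n : ℕ} (S : Set (Fin n → ℝ)) (hS : Convex ℝ S) (a p q : Fin n → ℝ)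
    (hp : p ∈ S) (hq : q ∈ S)
    (hmin : ∀ r ∈ S, (a - p) ⬝ᵥ (a - p) ≤ (a - r) ⬝ᵥ (a - r)) :
    (a - p) ⬝ᵥ (q - p) ≤ 0 := by
  have key : ∀ t : ℝ, 0 < t → t ≤ 1 →
      2 * ((a - p) ⬝ᵥ (q - p)) ≤ t * ((q - p) ⬝ᵥ (q - p)) := by
    intro t ht ht1
    have h1 := hmin _ (hS.add_smul_sub_mem hp hq ⟨ht.le, ht1⟩)
    have h2 : a - (p + t • (q - p)) = (a - p) - t • (q - p) := by abel
    rw [h2] at h1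
    generalize a - p = e at *
    generalize q - p = d at *
    simp only [sub_dotProduct, dotProduct_sub, smul_dotProduct, dotProduct_smul,
      smul_eq_mul] at h1
    rw [dotProduct_comm d e] at h1
    have h3 : t * (2 * (e ⬝ᵥ d)) ≤ t * (t * (d ⬝ᵥ d)) := by linarith
    exact le_of_mul_le_mul_left h3 ht
  by_contra hc
  push Not at hc
  have hd : 0 ≤ (q - p) ⬝ᵥ (q - p) := by
    simpa using dotProduct_star_self_nonneg (q - p)
  generalize (a - p) ⬝ᵥ (q - p) = c at *
  generalize (q - p) ⬝ᵥ (q - p) = d at *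
  have hpos : 0 < c + d := by linarith
  have h4 := key (c / (c + d)) (by positivity) (by rw [div_le_one hpos]; linarith)
  have h5 : c / (c + d) * d ≤ c := by
    rw [div_mul_eq_mul_div, div_le_iff₀ hpos]; nlinarith
  linarith

lemma aux_trace {a b : ℕ} (A : Matrix (Fin a) (Fin b) ℝ) (e : Fin a → ℝ) (X : Fin b → ℝ)
    (l : ℝ) :
    ((A - l • vecMulVec e X)ᵀ * (A - l • vecMulVec e X)).trace =
      (Aᵀ * A).trace - 2 * l * (e ⬝ᵥ A.mulVec X) + l ^ 2 * ((e ⬝ᵥ e) * (X ⬝ᵥ X)) := by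
  have h1 : (Aᵀ * vecMulVec e X).trace = e ⬝ᵥ A.mulVec X := by
    rw [mul_vecMulVec, trace_vecMulVec, mulVec_transpose, dotProduct_mulVec]
  have h2 : ((vecMulVec e X)ᵀ * A).trace = e ⬝ᵥ A.mulVec X := by
    rw [← h1, ← trace_transpose, transpose_mul, transpose_transpose]
  have h3 : ((vecMulVec e X)ᵀ * vecMulVec e X).trace = (e ⬝ᵥ e) * (X ⬝ᵥ X) := by
    rw [transpose_vecMulVec, vecMulVec_mul_vecMulVec, trace_vecMulVec]
    simp
  simp only [transpose_sub, transpose_smul, Matrix.sub_mul, Matrix.mul_sub, trace_sub, Matrix.smul_mul,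
    Matrix.mul_smul, trace_smul, h1, h2, h3, smul_eq_mul]
  ring

lemma aux_trace_nonneg {a b : ℕ} (A : Matrix (Fin a) (Fin b) ℝ) : 0 ≤ (Aᵀ * A).trace := by
  rw [trace]
  refine Finset.sum_nonneg fun i _ => ?_
  rw [diag_apply, mul_apply]
  exact Finset.sum_nonneg fun j _ => mul_self_nonneg _

lemma aux_step {a b : ℕ} (A B : Matrix (Fin a) (Fin b) ℝ) (S : Set (Fin a → ℝ))
    (hS : Convex ℝ S) (X : Fin b → ℝ) (r p q : Fin a → ℝ) (l α : ℝ)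
    (hp : p ∈ S) (hq : q ∈ S)
    (hmin : ∀ s ∈ S, (r - p) ⬝ᵥ (r - p) ≤ (r - s) ⬝ᵥ (r - s))
    (hr : r = (A - B).mulVec X + q) (hl : 0 ≤ l) (hlX : l * (X ⬝ᵥ X) ≤ 2 - α) :
    ((A - (B + l • vecMulVec (r - p) X))ᵀ * (A - (B + l • vecMulVec (r - p) X))).trace
      ≤ ((A - B)ᵀ * (A - B)).trace - l * α * ((r - p) ⬝ᵥ (r - p)) := by
  have h1 := aux_proj S hS r p q hp hq hmin
  have h2 : (A - B).mulVec X = (r - p) - (q - p) := by rw [hr]; abel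
  rw [← sub_sub, aux_trace, h2, dotProduct_sub]
  have hd : 0 ≤ (r - p) ⬝ᵥ (r - p) := by
    simpa using dotProduct_star_self_nonneg (r - p)
  generalize (r - p) ⬝ᵥ (r - p) = d at *
  generalize (r - p) ⬝ᵥ (q - p) = c at *
  have h3 := mul_le_mul_of_nonneg_left hlX (mul_nonneg hl hd)
  have h4 := mul_nonneg hl (neg_nonneg.2 h1)
  nlinarith

lemma aux_tri {n : ℕ} (a b : Fin n → ℝ) :
    √(a ⬝ᵥ a) ≤ √((a - b) ⬝ᵥ (a - b)) + √(b ⬝ᵥ b) := by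
  have hh : ∀ c : Fin n → ℝ, √(c ⬝ᵥ c) = ‖WithLp.toLp 2 c‖ := by
    intro c
    rw [EuclideanSpace.norm_eq]
    simp [dotProduct, sq]
  rw [hh, hh, hh]
  have := norm_add_le (WithLp.toLp 2 (a - b)) (WithLp.toLp 2 b)
  rwa [← WithLp.toLp_add, sub_add_cancel] at this

/-- Theorem 2: robust adaptation. (i) The Lyapunov function is nonincreasing, hence the
parameter approximation errors are uniformly bounded; (ii) the state prediction error is
ultimately bounded by `ε_v`: `limsup_{k→∞} ‖x̃_k‖ ≤ ε_v`. -/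
theorem robust_adaptation_ultimate_bound
    (h n m : ℕ) (hh : 1 ≤ h) (hn : 1 ≤ n) (hm : 1 ≤ m)
    (α : ℝ) (hα : 0 < α) (hα2 : α < 2)
    (Ψ : Matrix (Fin h) (Fin (h + m)) ℝ) (C : Matrix (Fin n) (Fin h) ℝ)
    (W : Set (Fin h → ℝ)) (Vs : Set (Fin n → ℝ))
    (hWne : W.Nonempty) (hWcl : IsClosed W) (hWcv : Convex ℝ W)
    (hWbd : Bornology.IsBounded W)
    (hVne : Vs.Nonempty) (hVcl : IsClosed Vs) (hVcv : Convex ℝ Vs)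
    (hVbd : Bornology.IsBounded Vs)
    (X : ℕ → Fin (h + m) → ℝ) (g : ℕ → Fin h → ℝ) (x : ℕ → Fin n → ℝ)
    (w : ℕ → Fin h → ℝ) (v : ℕ → Fin n → ℝ)
    (hw : ∀ k ≥ 1, w k ∈ W) (hv : ∀ k ≥ 1, v k ∈ Vs)
    (hgdyn : ∀ k ≥ 1, g (k + 1) = Ψ.mulVec (X k) + w k)
    (hxdyn : ∀ k ≥ 1, x (k + 1) = C.mulVec (g (k + 1)) + v k)
    (hXne : ∀ k ≥ 1, X k ≠ 0) (hgne : ∀ k ≥ 1, g (k + 1) ≠ 0)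
    (Ψhat : ℕ → Matrix (Fin h) (Fin (h + m)) ℝ) (Chat : ℕ → Matrix (Fin n) (Fin h) ℝ)
    (gt : ℕ → Fin h → ℝ) (xt : ℕ → Fin n → ℝ) (lam : ℕ → ℝ)
    (wstar : ℕ → Fin h → ℝ) (vstar : ℕ → Fin n → ℝ)
    (hgt : ∀ k ≥ 1, gt (k + 1) = g (k + 1) - (Ψhat k).mulVec (X k))
    (hxt : ∀ k ≥ 1, xt (k + 1) = x (k + 1) - (Chat k).mulVec (g (k + 1)))
    (hwstar : ∀ k ≥ 1, wstar k ∈ W) (hvstar : ∀ k ≥ 1, vstar k ∈ Vs)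
    (hstarmin : ∀ k ≥ 1, ∀ w' ∈ W, ∀ v' ∈ Vs,
      (gt (k + 1) - wstar k) ⬝ᵥ (gt (k + 1) - wstar k)
        + (xt (k + 1) - vstar k) ⬝ᵥ (xt (k + 1) - vstar k) ≤
      (gt (k + 1) - w') ⬝ᵥ (gt (k + 1) - w')
        + (xt (k + 1) - v') ⬝ᵥ (xt (k + 1) - v'))
    (hlam : ∀ k ≥ 1, lam k =
      min ((2 - α) / (X k ⬝ᵥ X k)) ((2 - α) / (g (k + 1) ⬝ᵥ g (k + 1))))
    (hΨup : ∀ k ≥ 1, Ψhat (k + 1)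
        = Ψhat k + lam k • vecMulVec (gt (k + 1) - wstar k) (X k))
    (hCup : ∀ k ≥ 1, Chat (k + 1)
        = Chat k + lam k • vecMulVec (xt (k + 1) - vstar k) (g (k + 1)))
    (V : ℕ → ℝ)
    (hV : ∀ k ≥ 1, V k = ((Ψ - Ψhat k)ᵀ * (Ψ - Ψhat k)).trace
        + ((C - Chat k)ᵀ * (C - Chat k)).trace)
    (Mb : ℝ) (hMb : 0 < Mb)
    (hXb : ∀ k ≥ 1, X k ⬝ᵥ X k ≤ Mb) (hgb : ∀ k ≥ 1, g (k + 1) ⬝ᵥ g (k + 1) ≤ Mb)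
    (εw εv : ℝ) (hεw : 0 < εw) (hεv : 0 < εv)
    (hWb : ∀ w' ∈ W, Real.sqrt (w' ⬝ᵥ w') ≤ εw)
    (hVb : ∀ v' ∈ Vs, Real.sqrt (v' ⬝ᵥ v') ≤ εv) :
    (∀ k ≥ 1, V (k + 1) ≤ V k) ∧
    (∀ k ≥ 1, ((Ψ - Ψhat k)ᵀ * (Ψ - Ψhat k)).trace ≤ V 1 ∧
        ((C - Chat k)ᵀ * (C - Chat k)).trace ≤ V 1) ∧
    Filter.limsup (fun k => Real.sqrt (xt k ⬝ᵥ xt k)) Filter.atTop ≤ εv := by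
  have pos : ∀ {a : ℕ} (y : Fin a → ℝ), 0 ≤ y ⬝ᵥ y := fun y => by
    simpa using dotProduct_star_self_nonneg y
  have pos' : ∀ {a : ℕ} (y : Fin a → ℝ), y ≠ 0 → 0 < y ⬝ᵥ y := fun y hy =>
    lt_of_le_of_ne (pos y) fun h0 => hy (dotProduct_self_eq_zero.1 h0.symm)
  set c : ℝ := (2 - α) / Mb with hc
  have hα2' : 0 < 2 - α := by linarith
  have hcpos : 0 < c := div_pos hα2' hMb
  have hlc : ∀ k ≥ 1, c ≤ lam k := by
    intro k hk
    rw [hlam k hk]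
    exact le_min (div_le_div_of_nonneg_left hα2'.le (pos' _ (hXne k hk)) (hXb k hk))
      (div_le_div_of_nonneg_left hα2'.le (pos' _ (hgne k hk)) (hgb k hk))
  have hdec : ∀ k ≥ 1, V (k + 1) ≤ V k
      - c * α * ((xt (k + 1) - vstar k) ⬝ᵥ (xt (k + 1) - vstar k)) := by
    intro k hk
    have hl := hlc k hk
    have hl0 : 0 ≤ lam k := hcpos.le.trans hl
    have s1 := aux_step Ψ (Ψhat k) W hWcv (X k) (gt (k + 1)) (wstar k) (w k) (lam k) α
      (hwstar k hk) (hw k hk)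
      (fun s hs => by have := hstarmin k hk s hs _ (hvstar k hk); linarith)
      (by rw [hgt k hk, hgdyn k hk, sub_mulVec]; abel) hl0
      (by rw [← le_div_iff₀ (pos' _ (hXne k hk)), hlam k hk]; exact min_le_left _ _)
    have s2 := aux_step C (Chat k) Vs hVcv (g (k + 1)) (xt (k + 1)) (vstar k) (v k) (lam k) α
      (hvstar k hk) (hv k hk)
      (fun s hs => by have := hstarmin k hk _ (hwstar k hk) s hs; linarith)
      (by rw [hxt k hk, hxdyn k hk, sub_mulVec]; abel) hl0
      (by rw [← le_div_iff₀ (pos' _ (hgne k hk)), hlam k hk]; exact min_le_right _ _)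
    rw [← hΨup k hk] at s1
    rw [← hCup k hk] at s2
    rw [hV (k + 1) (by omega), hV k hk]
    have p1 := mul_nonneg (mul_nonneg hl0 hα.le) (pos (gt (k + 1) - wstar k))
    have p2 := mul_le_mul_of_nonneg_right (mul_le_mul_of_nonneg_right hl hα.le)
      (pos (xt (k + 1) - vstar k))
    linarith
  have hmono : ∀ k ≥ 1, V (k + 1) ≤ V k := by
    intro k hk
    have p2 := mul_nonneg (mul_nonneg hcpos.le hα.le) (pos (xt (k + 1) - vstar k))
    linarith [hdec k hk]
  have hV1 : ∀ k ≥ 1, V k ≤ V 1 := by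
    intro k hk
    induction k, hk using Nat.le_induction with
    | base => exact le_rfl
    | succ k hk ih => exact (hmono k hk).trans ih
  refine ⟨hmono, ?_, ?_⟩
  · intro k hk
    have h1 := hV1 k hk
    rw [hV k hk] at h1
    have := aux_trace_nonneg (Ψ - Ψhat k)
    have := aux_trace_nonneg (C - Chat k)
    constructor <;> linarith
  · have hanti : Antitone (fun k => V (k + 1)) :=
      antitone_nat_of_succ_le fun k => hmono (k + 1) (by omega)
    have hbdd : BddBelow (Set.range fun k => V (k + 1)) := by
      refine ⟨0, ?_⟩
      rintro _ ⟨k, rfl⟩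
      simp only
      rw [hV (k + 1) (by omega)]
      exact add_nonneg (aux_trace_nonneg _) (aux_trace_nonneg _)
    have ht := tendsto_atTop_ciInf hanti hbdd
    have ht2 := ht.sub (ht.comp (Filter.tendsto_add_atTop_nat 1))
    rw [sub_self] at ht2
    refine le_of_forall_pos_le_add fun δ hδ => ?_
    refine Filter.limsup_le_of_le
      (Filter.isCoboundedUnder_le_of_le Filter.atTop (x := 0) fun k => Real.sqrt_nonneg _) ?_
    have hev := ht2.eventually (gt_mem_nhds (show (0:ℝ) < c * α * δ ^ 2 by positivity))
    obtain ⟨N, hN⟩ := Filter.eventually_atTop.1 hev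
    refine Filter.eventually_atTop.2 ⟨N + 2, fun k hk => ?_⟩
    obtain ⟨j, rfl⟩ : ∃ j, k = j + 1 + 1 := ⟨k - 2, by omega⟩
    have h1 := hN j (by omega)
    simp only [Function.comp] at h1
    have h2 := hdec (j + 1) (by omega)
    have h3 : (xt (j + 1 + 1) - vstar (j + 1)) ⬝ᵥ (xt (j + 1 + 1) - vstar (j + 1)) ≤ δ ^ 2 := by
      refine le_of_mul_le_mul_left ?_ (mul_pos hcpos hα)
      linarith
    have h4 := Real.sqrt_le_sqrt h3
    rw [Real.sqrt_sq hδ.le] at h4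
    have h5 := aux_tri (xt (j + 1 + 1)) (vstar (j + 1))
    have h6 := hVb _ (hvstar (j + 1) (by omega))
    linarith
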